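/- arXiv:1406.5622 — 2 statements merged into one kernel-verified Lean document; each statement's English description precedes it below -/
import Mathlib

section
/- Fix ρ ∈ Γ and α > 0. Suppose the coupled LMIs at ρ are feasible with solution (τᵢ, θᵢ, Xᵢ), i = 1,…,N, and define the protocol gains Kᵢⱼ := γ²Xᵢ⁻¹HᵢⱼᵀFᵢⱼ⁻¹ and Lᵢ := (γ²Xᵢ⁻¹C₂ᵢᵀ − B₂ᵢD₂ᵢᵀ)E₂ᵢ⁻¹. Then, in the absence of disturbances (w₀ ≡ 0, wᵢ ≡ 0, wᵢⱼ ≡ 0), for every solution of the fixed-parameter closed-loop system, there exist constants c > 0 and ω > 0 such that the synchronization errors satisfy ‖eᵢ(t)‖² = ‖x(t) − xᵢ(t)‖² ≤ c e^{−ωt} for all t ≥ 0 and all i = 1,…,N. -/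
open MeasureTheory Matrix Set Filter

noncomputable section

/-- Frobenius norm of a square real matrix (a fixed choice of matrix norm). -/
def frobNorm {n : ℕ} (M : Matrix (Fin n) (Fin n) ℝ) : ℝ :=
  Real.sqrt (∑ i, ∑ j, (M i j) ^ 2)

/-- A function `f : [0,∞) → ℝ^k` belongs to `L₂[0,∞)` (its squared Euclidean
norm is integrable on `[0,∞)`). -/
def IsL2 {k : ℕ} (f : ℝ → Fin k → ℝ) : Prop :=
  MeasureTheory.IntegrableOn (fun t => f t ⬝ᵥ f t) (Set.Ici 0) MeasureTheory.volume

/-- The data of the multi-agent network: the directed graph (given by the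
in-neighbourhood sets `V i`, with no self-loops), the coefficient matrices of the
reference system, the agents, the measurements and the communication channels, the
Lipschitz-bound matrix `R`, the performance weights `Q i`, and the constants
`γ` (`gam`) and `δ i`. -/
structure NetData (n l m r r0 N : ℕ) where
  V : Fin N → Finset (Fin N)
  B1 : Matrix (Fin n) (Fin l) ℝ
  B20 : Matrix (Fin n) (Fin r0) ℝ
  B2 : Fin N → Matrix (Fin n) (Fin r) ℝ
  C2 : Fin N → Matrix (Fin m) (Fin n) ℝ
  D2 : Fin N → Matrix (Fin m) (Fin r) ℝ
  H : Fin N → Fin N → Matrix (Fin m) (Fin n) ℝ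
  G : Fin N → Fin N → Matrix (Fin m) (Fin r) ℝ
  R : Matrix (Fin n) (Fin n) ℝ
  Q : Fin N → Matrix (Fin n) (Fin n) ℝ
  gam : ℝ
  δ : Fin N → ℝ

namespace NetData

variable {n l m r r0 N : ℕ} (d : NetData n l m r r0 N)

def E (i : Fin N) : Matrix (Fin m) (Fin m) ℝ := d.D2 i * (d.D2 i)ᵀ

def F (i j : Fin N) : Matrix (Fin m) (Fin m) ℝ := d.G i j * (d.G i j)ᵀ

/-- in-degree `p i` -/
def pdeg (i : Fin N) : ℕ := (d.V i).card

/-- out-degree `q i` -/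
def qdeg (i : Fin N) : ℕ := (Finset.univ.filter fun j => i ∈ d.V j).card

/-- Standing assumptions: no self-loops, `E₂ᵢ ≻ 0`, `Fᵢⱼ ≻ 0` on edges,
`R ⪰ 0`, `γ > 0`, `δᵢ > 0`, `Qᵢ ≻ 0`. -/
def Standing : Prop :=
  (∀ i, i ∉ d.V i) ∧ (∀ i, (d.E i).PosDef) ∧ (∀ i j, j ∈ d.V i → (d.F i j).PosDef)
    ∧ d.R.PosSemidef ∧ 0 < d.gam ∧ (∀ i, 0 < d.δ i) ∧ (∀ i, (d.Q i).PosDef)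

/-- The global Lipschitz condition (4) on the nonlinearity `φ`. -/
def LipOK (φ : (Fin n → ℝ) → Fin l → ℝ) : Prop :=
  ∀ a b : Fin n → ℝ, (φ a - φ b) ⬝ᵥ (φ a - φ b) ≤ (a - b) ⬝ᵥ (d.R *ᵥ (a - b))

def Acl (Aρ : Matrix (Fin n) (Fin n) ℝ) (i : Fin N) : Matrix (Fin n) (Fin n) ℝ :=
  Aρ + d.δ i • (1 : Matrix (Fin n) (Fin n) ℝ) + d.B2 i * (d.D2 i)ᵀ * (d.E i)⁻¹ * d.C2 i

/-- The matrix `Sᵢ(ρ)` of the coupled LMIs (12), evaluated at `A(ρ) = Aρ`. -/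
def Smat (Aρ : Matrix (Fin n) (Fin n) ℝ) (X : Fin N → Matrix (Fin n) (Fin n) ℝ)
    (i : Fin N) : Matrix (Fin n) (Fin n) ℝ :=
  X i * d.Acl Aρ i + (d.Acl Aρ i)ᵀ * X i
    + ((d.pdeg i + d.qdeg i : ℕ) : ℝ) • (1 : Matrix (Fin n) (Fin n) ℝ)
    - d.gam ^ 2 • ((d.C2 i)ᵀ * (d.E i)⁻¹ * d.C2 i)
    - d.gam ^ 2 • (∑ j ∈ d.V i, (d.H i j)ᵀ * (d.F i j)⁻¹ * d.H i j)
    + d.Q i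

/-- The quadratic form of the reduced coupled LMI (18):
`z ↦ zᵀ [[Sᵢ(ρ)+τᵢR, Tᵢ],[Tᵢᵀ, −Υᵢ]] z` for `z = (ξ, a, bv, c, (v j)_{j ∈ V i})`. -/
def redQF (Aρ : Matrix (Fin n) (Fin n) ℝ) (τ : Fin N → ℝ)
    (X : Fin N → Matrix (Fin n) (Fin n) ℝ) (i : Fin N)
    (ξ : Fin n → ℝ) (a : Fin r0 → ℝ) (bv : Fin r → ℝ) (c : Fin l → ℝ)
    (v : Fin N → Fin n → ℝ) : ℝ :=
  ξ ⬝ᵥ (d.Smat Aρ X i *ᵥ ξ) + τ i * (ξ ⬝ᵥ (d.R *ᵥ ξ))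
    + 2 * (ξ ⬝ᵥ ((X i * d.B20) *ᵥ a))
    + 2 * (ξ ⬝ᵥ ((X i * d.B2 i *
        ((1 : Matrix (Fin r) (Fin r) ℝ) - (d.D2 i)ᵀ * (d.E i)⁻¹ * d.D2 i)) *ᵥ bv))
    + 2 * (ξ ⬝ᵥ ((X i * d.B1) *ᵥ c))
    + 2 * ∑ j ∈ d.V i,
        ξ ⬝ᵥ ((d.gam ^ 2 • ((d.H i j)ᵀ * (d.F i j)⁻¹ * d.H i j)
          - (1 : Matrix (Fin n) (Fin n) ℝ)) *ᵥ v j)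
    - d.gam ^ 2 * (a ⬝ᵥ a) - d.gam ^ 2 * (bv ⬝ᵥ bv) - τ i * (c ⬝ᵥ c)
    - ∑ j ∈ d.V i, (2 * d.δ j / ((d.qdeg j : ℝ) + 1)) * (v j ⬝ᵥ (X j *ᵥ v j))

/-- The reduced coupled LMIs (18): negative definiteness of each block matrix,
expressed via its quadratic form. -/
def ReducedLMI (Aρ : Matrix (Fin n) (Fin n) ℝ) (τ : Fin N → ℝ)
    (X : Fin N → Matrix (Fin n) (Fin n) ℝ) : Prop :=
  ∀ (i : Fin N) (ξ : Fin n → ℝ) (a : Fin r0 → ℝ) (bv : Fin r → ℝ) (c : Fin l → ℝ)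
    (v : Fin N → Fin n → ℝ),
    ¬(ξ = 0 ∧ a = 0 ∧ bv = 0 ∧ c = 0 ∧ ∀ j ∈ d.V i, v j = 0) →
    d.redQF Aρ τ X i ξ a bv c v < 0

/-- The quadratic form of the full coupled LMI (12), for
`z = (ξ, a, bv, c, (v j)_{j ∈ V i}, zz)`. -/
def fullQF (Aρ : Matrix (Fin n) (Fin n) ℝ) (α : ℝ) (τ θ : Fin N → ℝ)
    (X : Fin N → Matrix (Fin n) (Fin n) ℝ) (i : Fin N)
    (ξ : Fin n → ℝ) (a : Fin r0 → ℝ) (bv : Fin r → ℝ) (c : Fin l → ℝ)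
    (v : Fin N → Fin n → ℝ) (zz : Fin n → ℝ) : ℝ :=
  d.redQF Aρ τ X i ξ a bv c v + θ i * α ^ 2 * (ξ ⬝ᵥ ξ)
    + 2 * (ξ ⬝ᵥ (X i *ᵥ zz)) - θ i * (zz ⬝ᵥ zz)

/-- The coupled LMIs (12) at the point `ρ` (with `A(ρ) = Aρ`) with uncertainty
size `α`: negative definiteness of each block matrix, via its quadratic form. -/
def CoupledLMI (Aρ : Matrix (Fin n) (Fin n) ℝ) (α : ℝ) (τ θ : Fin N → ℝ)
    (X : Fin N → Matrix (Fin n) (Fin n) ℝ) : Prop :=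
  ∀ (i : Fin N) (ξ : Fin n → ℝ) (a : Fin r0 → ℝ) (bv : Fin r → ℝ) (c : Fin l → ℝ)
    (v : Fin N → Fin n → ℝ) (zz : Fin n → ℝ),
    ¬(ξ = 0 ∧ a = 0 ∧ bv = 0 ∧ c = 0 ∧ (∀ j ∈ d.V i, v j = 0) ∧ zz = 0) →
    d.fullQF Aρ α τ θ X i ξ a bv c v zz < 0

/-- Feasibility of the coupled LMIs (12): positivity of scalar variables,
positive definiteness of the `Xᵢ` and the LMIs themselves. -/
def Feasible (Aρ : Matrix (Fin n) (Fin n) ℝ) (α : ℝ) (τ θ : Fin N → ℝ)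
    (X : Fin N → Matrix (Fin n) (Fin n) ℝ) : Prop :=
  (∀ i, 0 < τ i) ∧ (∀ i, 0 < θ i) ∧ (∀ i, (X i).PosDef) ∧ d.CoupledLMI Aρ α τ θ X

/-- Interconnection gains `Kᵢⱼ = γ²Xᵢ⁻¹HᵢⱼᵀFᵢⱼ⁻¹`. -/
def Kgain (X : Fin N → Matrix (Fin n) (Fin n) ℝ) (i j : Fin N) :
    Matrix (Fin n) (Fin m) ℝ :=
  d.gam ^ 2 • ((X i)⁻¹ * (d.H i j)ᵀ * (d.F i j)⁻¹)

/-- Observer gains `Lᵢ = (γ²Xᵢ⁻¹C₂ᵢᵀ − B₂ᵢD₂ᵢᵀ)E₂ᵢ⁻¹`. -/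
def Lgain (X : Fin N → Matrix (Fin n) (Fin n) ℝ) (i : Fin N) :
    Matrix (Fin n) (Fin m) ℝ :=
  (d.gam ^ 2 • ((X i)⁻¹ * (d.C2 i)ᵀ) - d.B2 i * (d.D2 i)ᵀ) * (d.E i)⁻¹

/-- `x, (xa i)` is a solution of the closed-loop system: the reference system (5)
(with the extra uncertainty `ψ`), the agents (6), the measurements (3), and the
protocol (8) with (possibly time-varying) gains `K t i j`, `L t i`. -/
def ClosedLoop (Aρ : ℝ → Matrix (Fin n) (Fin n) ℝ)
    (φ : (Fin n → ℝ) → Fin l → ℝ) (ψ : ℝ → (Fin n → ℝ) → Fin n → ℝ)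
    (K : ℝ → Fin N → Fin N → Matrix (Fin n) (Fin m) ℝ)
    (L : ℝ → Fin N → Matrix (Fin n) (Fin m) ℝ)
    (w0 : ℝ → Fin r0 → ℝ) (w : Fin N → ℝ → Fin r → ℝ)
    (wE : Fin N → Fin N → ℝ → Fin r → ℝ)
    (x : ℝ → Fin n → ℝ) (xa : Fin N → ℝ → Fin n → ℝ) : Prop :=
  (∀ t ∈ Ici (0:ℝ),
    HasDerivAt x (Aρ t *ᵥ x t + d.B1 *ᵥ φ (x t) + d.B20 *ᵥ w0 t + ψ t (x t)) t) ∧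
  ∀ i, ∀ t ∈ Ici (0:ℝ),
    HasDerivAt (xa i)
      (Aρ t *ᵥ xa i t + d.B1 *ᵥ φ (xa i t) + ψ t (xa i t)
        + (L t i *ᵥ ((d.C2 i *ᵥ x t + d.D2 i *ᵥ w i t) - d.C2 i *ᵥ xa i t)
          + ∑ j ∈ d.V i, K t i j *ᵥ ((d.H i j *ᵥ xa j t + d.G i j *ᵥ wE i j t)
              - d.H i j *ᵥ xa i t))
        + d.B2 i *ᵥ w i t) t

/-- The disagreement function `Ψ_G` (11). -/
def disagree (e : Fin N → Fin n → ℝ) : ℝ :=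
  (1 / (N : ℝ)) * ∑ i, ∑ j ∈ d.V i, (e j - e i) ⬝ᵥ (e j - e i)

/-- `‖(x₀,w₀,w,w̄)‖²` with `P = diag[(1/N)Xᵢ]`. -/
def distSq (X : Fin N → Matrix (Fin n) (Fin n) ℝ) (x0 : Fin n → ℝ)
    (x0a : Fin N → Fin n → ℝ) (w0 : ℝ → Fin r0 → ℝ) (w : Fin N → ℝ → Fin r → ℝ)
    (wE : Fin N → Fin N → ℝ → Fin r → ℝ) : ℝ :=
  (1 / (N : ℝ)) * ∑ i, (x0 - x0a i) ⬝ᵥ (X i *ᵥ (x0 - x0a i))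
    + (∫ t in Ici (0:ℝ), w0 t ⬝ᵥ w0 t)
    + (1 / (N : ℝ)) * ∑ i, ((∫ t in Ici (0:ℝ), w i t ⬝ᵥ w i t)
        + ∑ j ∈ d.V i, ∫ t in Ici (0:ℝ), wE i j t ⬝ᵥ wE i j t)

end NetData

theorem Matrix.IsHermitian.dotProduct_mulVec_comm {n : ℕ} {M : Matrix (Fin n) (Fin n) ℝ}
    (hM : M.IsHermitian) (a b : Fin n → ℝ) : a ⬝ᵥ (M *ᵥ b) = b ⬝ᵥ (M *ᵥ a) := by
  have hT : Mᵀ = M := by simpa [conjTranspose_eq_transpose_of_trivial] using hM.eq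
  rw [dotProduct_mulVec, ← mulVec_transpose, hT, dotProduct_comm]

/-- A positive definite quadratic form is coercive. -/
theorem Matrix.PosDef.exists_mul_dotProduct_le {n : ℕ} {M : Matrix (Fin n) (Fin n) ℝ}
    (hM : M.PosDef) : ∃ κ > (0 : ℝ), ∀ v : Fin n → ℝ, v ⬝ᵥ v ≤ κ * (v ⬝ᵥ (M *ᵥ v)) := by
  have hpos : ∀ v : Fin n → ℝ, v ≠ 0 → 0 < v ⬝ᵥ (M *ᵥ v) := fun v hv => by
    simpa using hM.dotProduct_mulVec_pos hv
  have hcont : ContinuousOn (fun v : Fin n → ℝ => (v ⬝ᵥ v) / (v ⬝ᵥ (M *ᵥ v)))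
      (Metric.sphere 0 1) := by
    refine ContinuousOn.div (by fun_prop) (by fun_prop) fun v hv => (hpos v ?_).ne'
    rintro rfl
    simp at hv
  obtain ⟨b, hb⟩ := (isCompact_sphere (0 : Fin n → ℝ) 1).bddAbove_image hcont
  refine ⟨max b 1, by positivity, fun v => ?_⟩
  by_cases hv : v = 0
  · simp [hv]
  have hnorm : ‖v‖ ≠ 0 := norm_ne_zero_iff.mpr hv
  have hle := hb ⟨‖v‖⁻¹ • v, by simp [norm_smul, hnorm], rfl⟩
  simp only [mulVec_smul, smul_dotProduct, dotProduct_smul, smul_eq_mul] at hle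
  rw [mul_div_mul_left _ _ (inv_ne_zero hnorm), mul_div_mul_left _ _ (inv_ne_zero hnorm),
    div_le_iff₀ (hpos v hv)] at hle
  exact hle.trans (mul_le_mul_of_nonneg_right (le_max_left _ _) (hpos v hv).le)

/-- A differentiable function with `W' ≤ -ω W` on `[0,∞)` decays exponentially. -/
theorem le_mul_exp_of_hasDerivAt_le {W W' : ℝ → ℝ} {ω : ℝ}
    (hW : ∀ t ∈ Ici (0 : ℝ), HasDerivAt W (W' t) t)
    (hle : ∀ t ∈ Ici (0 : ℝ), W' t ≤ -ω * W t) {t : ℝ} (ht : t ∈ Ici (0 : ℝ)) :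
    W t ≤ W 0 * Real.exp (-ω * t) := by
  have hderiv : ∀ s ∈ Ici (0 : ℝ), HasDerivAt (fun s => W s * Real.exp (ω * s))
      (W' s * Real.exp (ω * s) + W s * (Real.exp (ω * s) * ω)) s := fun s hs => by
    have h := ((hasDerivAt_id s).const_mul ω).exp
    simp only [id, mul_one] at h
    exact (hW s hs).mul h
  have hanti : AntitoneOn (fun s => W s * Real.exp (ω * s)) (Ici 0) := by
    refine antitoneOn_of_deriv_nonpos (convex_Ici 0)
      (fun s hs => (hderiv s hs).continuousAt.continuousWithinAt)
      (fun s hs => (hderiv s (interior_subset hs)).differentiableAt.differentiableWithinAt)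
      fun s hs => ?_
    rw [(hderiv s (interior_subset hs)).deriv]
    nlinarith [hle s (interior_subset hs), Real.exp_pos (ω * s)]
  have h := hanti self_mem_Ici ht ht
  simp only [mul_zero, Real.exp_zero, mul_one] at h
  calc W t = W t * Real.exp (ω * t) * Real.exp (-ω * t) := by
        rw [mul_assoc, ← Real.exp_add]; simp
    _ ≤ _ := mul_le_mul_of_nonneg_right h (Real.exp_pos _).le

theorem HasDerivAt.dotProduct {n : ℕ} {u v : ℝ → Fin n → ℝ} {u' v' : Fin n → ℝ} {t : ℝ}
    (hu : HasDerivAt u u' t) (hv : HasDerivAt v v' t) :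
    HasDerivAt (fun s => u s ⬝ᵥ v s) (u' ⬝ᵥ v t + u t ⬝ᵥ v') t := by
  simp only [_root_.dotProduct, ← Finset.sum_add_distrib]
  exact HasDerivAt.fun_sum fun i _ => (hasDerivAt_pi.mp hu i).mul (hasDerivAt_pi.mp hv i)

theorem hasDerivAt_dotProduct_mulVec {n : ℕ} {M : Matrix (Fin n) (Fin n) ℝ} (hM : M.IsHermitian)
    {v : ℝ → Fin n → ℝ} {v' : Fin n → ℝ} {t : ℝ} (hv : HasDerivAt v v' t) :
    HasDerivAt (fun s => v s ⬝ᵥ (M *ᵥ v s)) (2 * (v t ⬝ᵥ (M *ᵥ v'))) t := by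
  have hMv : HasDerivAt (fun s => M *ᵥ v s) (M *ᵥ v') t :=
    (LinearMap.toContinuousLinearMap (Matrix.toLin' M)).hasFDerivAt.comp_hasDerivAt t hv
  convert hv.dotProduct hMv using 1
  rw [hM.dotProduct_mulVec_comm v']
  ring

/-- `vᵀ(MᵀP⁻¹M)v ≥ 0` for positive definite `P`. -/
theorem dotProduct_transpose_mul_inv_mul_nonneg {m n : ℕ} {P : Matrix (Fin m) (Fin m) ℝ}
    (hP : P.PosDef) (M : Matrix (Fin m) (Fin n) ℝ) (v : Fin n → ℝ) :
    0 ≤ v ⬝ᵥ ((Mᵀ * P⁻¹ * M) *ᵥ v) := by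
  simpa [conjTranspose_eq_transpose_of_trivial] using
    (hP.inv.posSemidef.conjTranspose_mul_mul_same M).dotProduct_mulVec_nonneg v

namespace NetData

variable {n l m r r0 N : ℕ} (d : NetData n l m r r0 N)

/-- Velocity of the synchronization error of agent `i` without disturbances, where `f` and `g`
are the increments of the two nonlinearities. -/
def errorField (Aρ : Matrix (Fin n) (Fin n) ℝ) (X : Fin N → Matrix (Fin n) (Fin n) ℝ)
    (e : Fin N → Fin n → ℝ) (f : Fin N → Fin l → ℝ) (g : Fin N → Fin n → ℝ) (i : Fin N) :
    Fin n → ℝ :=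
  Aρ *ᵥ e i + d.B1 *ᵥ f i + g i
    - (d.Lgain X i *ᵥ (d.C2 i *ᵥ e i)
      + ∑ j ∈ d.V i, d.Kgain X i j *ᵥ (d.H i j *ᵥ (e i - e j)))

variable {d}

theorem ClosedLoop.hasDerivAt_error {φ : (Fin n → ℝ) → Fin l → ℝ}
    {Aρ : Matrix (Fin n) (Fin n) ℝ} {ψ : ℝ → (Fin n → ℝ) → Fin n → ℝ}
    {X : Fin N → Matrix (Fin n) (Fin n) ℝ} {x : ℝ → Fin n → ℝ} {xa : Fin N → ℝ → Fin n → ℝ}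
    (hcl : d.ClosedLoop (fun _ => Aρ) φ ψ (fun _ => d.Kgain X) (fun _ => d.Lgain X)
      (fun _ => 0) (fun _ _ => 0) (fun _ _ _ => 0) x xa)
    (i : Fin N) {t : ℝ} (ht : t ∈ Ici (0 : ℝ)) :
    HasDerivAt (fun s => x s - xa i s)
      (d.errorField Aρ X (fun k => x t - xa k t) (fun k => φ (x t) - φ (xa k t))
        (fun k => ψ t (x t) - ψ t (xa k t)) i) t := by
  refine ((hcl.1 t ht).sub (hcl.2 i t ht)).congr_deriv ?_
  simp only [errorField, mulVec_zero, add_zero, mulVec_sub, sub_sub_sub_cancel_left]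
  abel

theorem dotProduct_Kgain {X : Fin N → Matrix (Fin n) (Fin n) ℝ} {i : Fin N} (hX : (X i).PosDef)
    (j : Fin N) (u v : Fin n → ℝ) :
    u ⬝ᵥ (X i *ᵥ (d.Kgain X i j *ᵥ (d.H i j *ᵥ v)))
      = d.gam ^ 2 * (u ⬝ᵥ (((d.H i j)ᵀ * (d.F i j)⁻¹ * d.H i j) *ᵥ v)) := by
  have hdet : IsUnit (X i).det := (Matrix.isUnit_iff_isUnit_det _).mp hX.isUnit
  have hmat : X i * (d.Kgain X i j * d.H i j)
      = d.gam ^ 2 • ((d.H i j)ᵀ * (d.F i j)⁻¹ * d.H i j) := by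
    simp only [Kgain, Matrix.smul_mul, Matrix.mul_smul, Matrix.mul_assoc]
    rw [Matrix.mul_nonsing_inv_cancel_left _ _ hdet]
  rw [mulVec_mulVec, mulVec_mulVec, Matrix.mul_assoc, hmat, smul_mulVec, dotProduct_smul, smul_eq_mul]

theorem dotProduct_Lgain {X : Fin N → Matrix (Fin n) (Fin n) ℝ} {i : Fin N} (hX : (X i).PosDef)
    (u v : Fin n → ℝ) :
    u ⬝ᵥ (X i *ᵥ (d.Lgain X i *ᵥ (d.C2 i *ᵥ v)))
      = d.gam ^ 2 * (u ⬝ᵥ (((d.C2 i)ᵀ * (d.E i)⁻¹ * d.C2 i) *ᵥ v))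
        - u ⬝ᵥ (X i *ᵥ ((d.B2 i * (d.D2 i)ᵀ * (d.E i)⁻¹ * d.C2 i) *ᵥ v)) := by
  have hdet : IsUnit (X i).det := (Matrix.isUnit_iff_isUnit_det _).mp hX.isUnit
  have hmat : X i * (d.Lgain X i * d.C2 i)
      = d.gam ^ 2 • ((d.C2 i)ᵀ * (d.E i)⁻¹ * d.C2 i)
        - X i * (d.B2 i * (d.D2 i)ᵀ * (d.E i)⁻¹ * d.C2 i) := by
    simp only [Lgain, Matrix.sub_mul, Matrix.mul_sub,
      Matrix.smul_mul, Matrix.mul_smul, Matrix.mul_assoc]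
    rw [Matrix.mul_nonsing_inv_cancel_left _ _ hdet]
  rw [mulVec_mulVec, mulVec_mulVec, Matrix.mul_assoc, hmat, sub_mulVec, smul_mulVec, dotProduct_sub,
    dotProduct_smul, smul_eq_mul, mulVec_mulVec]

/-- The quadratic form of `Sᵢ(ρ)`. -/
theorem dotProduct_Smat {X : Fin N → Matrix (Fin n) (Fin n) ℝ} {i : Fin N} (hX : (X i).PosDef)
    (Aρ : Matrix (Fin n) (Fin n) ℝ) (v : Fin n → ℝ) :
    v ⬝ᵥ (d.Smat Aρ X i *ᵥ v)
      = 2 * (v ⬝ᵥ (X i *ᵥ (Aρ *ᵥ v))) + 2 * d.δ i * (v ⬝ᵥ (X i *ᵥ v))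
        + 2 * (v ⬝ᵥ (X i *ᵥ ((d.B2 i * (d.D2 i)ᵀ * (d.E i)⁻¹ * d.C2 i) *ᵥ v)))
        + ((d.pdeg i : ℝ) + d.qdeg i) * (v ⬝ᵥ v)
        - d.gam ^ 2 * (v ⬝ᵥ (((d.C2 i)ᵀ * (d.E i)⁻¹ * d.C2 i) *ᵥ v))
        - d.gam ^ 2 * ∑ j ∈ d.V i, v ⬝ᵥ (((d.H i j)ᵀ * (d.F i j)⁻¹ * d.H i j) *ᵥ v)
        + v ⬝ᵥ (d.Q i *ᵥ v) := by
  have hT : v ⬝ᵥ (((d.Acl Aρ i)ᵀ * X i) *ᵥ v) = v ⬝ᵥ ((X i * d.Acl Aρ i) *ᵥ v) := by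
    rw [← mulVec_mulVec, ← mulVec_mulVec, dotProduct_mulVec, vecMul_transpose,
      hX.isHermitian.dotProduct_mulVec_comm]
  simp only [Smat, add_mulVec, sub_mulVec, dotProduct_add, dotProduct_sub, hT, smul_mulVec,
    dotProduct_smul, smul_eq_mul, one_mulVec, sum_mulVec, dotProduct_sum]
  simp only [Acl, ← mulVec_mulVec, add_mulVec, mulVec_add, dotProduct_add, smul_mulVec,
    mulVec_smul, dotProduct_smul, smul_eq_mul, one_mulVec, Nat.cast_add]
  ring

/-- Dissipation inequality for a single agent, obtained from the coupled LMIs. -/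
theorem Feasible.dissipation {Aρ : Matrix (Fin n) (Fin n) ℝ} {α : ℝ} {τ θ : Fin N → ℝ}
    {X : Fin N → Matrix (Fin n) (Fin n) ℝ} (hfeas : d.Feasible Aρ α τ θ X) (hstand : d.Standing)
    {e : Fin N → Fin n → ℝ} {f : Fin N → Fin l → ℝ} {g : Fin N → Fin n → ℝ} (i : Fin N)
    (hf : f i ⬝ᵥ f i ≤ e i ⬝ᵥ (d.R *ᵥ e i)) (hg : g i ⬝ᵥ g i ≤ α ^ 2 * (e i ⬝ᵥ e i)) :
    2 * (e i ⬝ᵥ (X i *ᵥ d.errorField Aρ X e f g i))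
      ≤ -(2 * d.δ i * (e i ⬝ᵥ (X i *ᵥ e i)))
        + ∑ j ∈ d.V i, 2 * d.δ j / ((d.qdeg j : ℝ) + 1) * (e j ⬝ᵥ (X j *ᵥ e j))
        - ((d.pdeg i : ℝ) + d.qdeg i) * (e i ⬝ᵥ e i) + 2 * ∑ j ∈ d.V i, e i ⬝ᵥ e j := by
  obtain ⟨hτ, hθ, hX, hlmi⟩ := hfeas
  obtain ⟨-, hE, hF, -, -, -, hQ⟩ := hstand
  have hfull : d.fullQF Aρ α τ θ X i (e i) 0 0 (f i) e (g i) ≤ 0 := by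
    by_cases h : e i = 0 ∧ (0 : Fin r0 → ℝ) = 0 ∧ (0 : Fin r → ℝ) = 0 ∧ f i = 0 ∧
        (∀ j ∈ d.V i, e j = 0) ∧ g i = 0
    · obtain ⟨he, -, -, hf0, hj, hg0⟩ := h
      have hsum : ∑ j ∈ d.V i, 2 * d.δ j / ((d.qdeg j : ℝ) + 1) * (e j ⬝ᵥ (X j *ᵥ e j)) = 0 :=
        Finset.sum_eq_zero fun j hjV => by simp [hj j hjV]
      simp [fullQF, redQF, he, hf0, hg0, hsum]
    · exact (hlmi i _ _ _ _ _ _ h).le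
  have hC := mul_nonneg (sq_nonneg d.gam)
    (dotProduct_transpose_mul_inv_mul_nonneg (hE i) (d.C2 i) (e i))
  have hH := mul_nonneg (sq_nonneg d.gam) (Finset.sum_nonneg fun j hj =>
    dotProduct_transpose_mul_inv_mul_nonneg (hF i j hj) (d.H i j) (e i))
  have hQe : 0 ≤ e i ⬝ᵥ (d.Q i *ᵥ e i) := by
    simpa using (hQ i).posSemidef.dotProduct_mulVec_nonneg (e i)
  have hτf := mul_le_mul_of_nonneg_left hf (hτ i).le
  have hθg := mul_le_mul_of_nonneg_left hg (hθ i).le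
  simp only [fullQF, redQF, dotProduct_Smat (hX i), mulVec_zero, dotProduct_zero, sub_mulVec,
    smul_mulVec, dotProduct_sub, dotProduct_smul, smul_eq_mul, one_mulVec,
    Finset.sum_sub_distrib, ← Finset.mul_sum, ← mulVec_mulVec (f i)] at hfull
  simp only [errorField, mulVec_add, mulVec_sub, dotProduct_add, dotProduct_sub,
    dotProduct_Lgain (hX i), mulVec_sum, dotProduct_sum, dotProduct_Kgain (hX i),
    Finset.sum_sub_distrib, ← Finset.mul_sum]
  linarith

theorem sum_sum_neighbours (a : Fin N → ℝ) :
    ∑ i, ∑ j ∈ d.V i, a j = ∑ j, (d.qdeg j : ℝ) * a j := by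
  simp only [qdeg, ← nsmul_eq_mul, ← Finset.sum_const]
  exact Finset.sum_comm' (by simp)

/-- The weighted sum of squared errors decays at every rate below `2δᵢ/(qᵢ+1)`. -/
theorem Feasible.sum_dissipation {Aρ : Matrix (Fin n) (Fin n) ℝ} {α : ℝ} {τ θ : Fin N → ℝ}
    {X : Fin N → Matrix (Fin n) (Fin n) ℝ} (hfeas : d.Feasible Aρ α τ θ X) (hstand : d.Standing)
    {e : Fin N → Fin n → ℝ} {f : Fin N → Fin l → ℝ} {g : Fin N → Fin n → ℝ}
    (hf : ∀ i, f i ⬝ᵥ f i ≤ e i ⬝ᵥ (d.R *ᵥ e i)) (hg : ∀ i, g i ⬝ᵥ g i ≤ α ^ 2 * (e i ⬝ᵥ e i))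
    {ω : ℝ} (hω : ∀ i, ω ≤ 2 * d.δ i / ((d.qdeg i : ℝ) + 1)) :
    ∑ i, 2 * (e i ⬝ᵥ (X i *ᵥ d.errorField Aρ X e f g i))
      ≤ -ω * ∑ i, e i ⬝ᵥ (X i *ᵥ e i) := by
  have hsum := Finset.sum_le_sum fun i (_ : i ∈ Finset.univ) =>
    hfeas.dissipation hstand i (hf i) (hg i)
  have hdiff : 0 ≤ ∑ i, ∑ j ∈ d.V i, (e i - e j) ⬝ᵥ (e i - e j) :=
    Finset.sum_nonneg fun i _ => Finset.sum_nonneg fun j _ => by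
      simpa using dotProduct_star_self_nonneg (e i - e j)
  have hexpand : ∑ i, ∑ j ∈ d.V i, (e i - e j) ⬝ᵥ (e i - e j)
      = ∑ i, (((d.pdeg i : ℝ) + d.qdeg i) * (e i ⬝ᵥ e i) - 2 * ∑ j ∈ d.V i, e i ⬝ᵥ e j) := by
    have hterm : ∀ i j, (e i - e j) ⬝ᵥ (e i - e j) = e i ⬝ᵥ e i - 2 * (e i ⬝ᵥ e j) + e j ⬝ᵥ e j :=
      fun i j => by
        simp only [dotProduct_sub, sub_dotProduct, dotProduct_comm (e j) (e i)]
        ring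
    simp only [hterm, Finset.sum_add_distrib, Finset.sum_sub_distrib, sum_sum_neighbours,
      Finset.sum_const, nsmul_eq_mul, ← Finset.mul_sum, add_mul, pdeg]
    ring
  have hrate : ∑ i, (-(2 * d.δ i * (e i ⬝ᵥ (X i *ᵥ e i)))
        + (d.qdeg i : ℝ) * (2 * d.δ i / ((d.qdeg i : ℝ) + 1) * (e i ⬝ᵥ (X i *ᵥ e i))))
      ≤ -ω * ∑ i, e i ⬝ᵥ (X i *ᵥ e i) := by
    rw [Finset.mul_sum]
    refine Finset.sum_le_sum fun i _ => ?_
    have hnn : 0 ≤ e i ⬝ᵥ (X i *ᵥ e i) := by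
      simpa using (hfeas.2.2.1 i).posSemidef.dotProduct_mulVec_nonneg (e i)
    have hδ : 2 * d.δ i = 2 * d.δ i / ((d.qdeg i : ℝ) + 1) * ((d.qdeg i : ℝ) + 1) := by
      field_simp
    have h := mul_le_mul_of_nonneg_right (hω i) hnn
    linear_combination h - (e i ⬝ᵥ (X i *ᵥ e i)) * hδ
  simp only [Finset.sum_add_distrib, Finset.sum_sub_distrib, sum_sum_neighbours] at hsum hrate
  rw [Finset.sum_sub_distrib] at hexpand
  linarith

end NetData

/-- **Lemma 1, property (i) (STATEMENT 0).** For fixed `ρ`, if the coupled LMIs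
(12) at `ρ` are feasible and the protocol gains are chosen as in (13)–(14),
then, in the absence of disturbances, the synchronization errors of the
closed-loop system decay exponentially: `‖x(t) − xᵢ(t)‖² ≤ c e^{−ωt}`. -/
theorem fixed_param_exponential_stability
    {n l m r r0 N : ℕ} (hN : 0 < N) (d : NetData n l m r r0 N) (hstand : d.Standing)
    (φ : (Fin n → ℝ) → Fin l → ℝ) (hφ : d.LipOK φ)
    (Aρ : Matrix (Fin n) (Fin n) ℝ) (α : ℝ) (hα : 0 < α)
    (ψ : ℝ → (Fin n → ℝ) → Fin n → ℝ)
    (hψ : ∀ t : ℝ, ∀ a b : Fin n → ℝ,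
      (ψ t a - ψ t b) ⬝ᵥ (ψ t a - ψ t b) ≤ α ^ 2 * ((a - b) ⬝ᵥ (a - b)))
    (τ θ : Fin N → ℝ) (X : Fin N → Matrix (Fin n) (Fin n) ℝ)
    (hfeas : d.Feasible Aρ α τ θ X)
    (x : ℝ → Fin n → ℝ) (xa : Fin N → ℝ → Fin n → ℝ)
    (hcl : d.ClosedLoop (fun _ => Aρ) φ ψ
      (fun _ => d.Kgain X) (fun _ => d.Lgain X)
      (fun _ => 0) (fun _ _ => 0) (fun _ _ _ => 0) x xa) :
    ∃ c > (0:ℝ), ∃ ω > (0:ℝ), ∀ i, ∀ t ∈ Ici (0:ℝ),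
      (x t - xa i t) ⬝ᵥ (x t - xa i t) ≤ c * Real.exp (-ω * t) := by
  have hδ := hstand.2.2.2.2.2.1
  have : Nonempty (Fin N) := ⟨⟨0, hN⟩⟩
  choose κ hκ hcoer using fun i => (hfeas.2.2.1 i).exists_mul_dotProduct_le
  obtain ⟨i₀, hi₀⟩ := Finite.exists_min fun i => 2 * d.δ i / ((d.qdeg i : ℝ) + 1)
  set ω := 2 * d.δ i₀ / ((d.qdeg i₀ : ℝ) + 1)
  have hωpos : 0 < ω := by have := hδ i₀; positivity
  obtain ⟨k₀, hk₀⟩ := Finite.exists_max κ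
  set W : ℝ → ℝ := fun t => ∑ i, (x t - xa i t) ⬝ᵥ (X i *ᵥ (x t - xa i t))
  have hterm : ∀ i t, 0 ≤ (x t - xa i t) ⬝ᵥ (X i *ᵥ (x t - xa i t)) := fun i t => by
    simpa using (hfeas.2.2.1 i).posSemidef.dotProduct_mulVec_nonneg (x t - xa i t)
  have hWnn : ∀ t, 0 ≤ W t := fun t => Finset.sum_nonneg fun i _ => hterm i t
  have hdecay : ∀ t ∈ Ici (0 : ℝ), W t ≤ W 0 * Real.exp (-ω * t) := fun t ht =>
    le_mul_exp_of_hasDerivAt_le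
      (fun s hs => HasDerivAt.fun_sum fun i _ =>
        hasDerivAt_dotProduct_mulVec (hfeas.2.2.1 i).isHermitian (hcl.hasDerivAt_error i hs))
      (fun s _ => hfeas.sum_dissipation hstand (fun _ => hφ _ _) (fun _ => hψ _ _ _) hi₀) ht
  refine ⟨κ k₀ * W 0 + 1, by nlinarith [mul_nonneg (hκ k₀).le (hWnn 0)], ω, hωpos,
    fun i t ht => ?_⟩
  calc (x t - xa i t) ⬝ᵥ (x t - xa i t)
      ≤ κ i * ((x t - xa i t) ⬝ᵥ (X i *ᵥ (x t - xa i t))) := hcoer i _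
    _ ≤ κ k₀ * W t := mul_le_mul (hk₀ i)
        (Finset.single_le_sum (fun j _ => hterm j t) (Finset.mem_univ i)) (hterm i t) (hκ k₀).le
    _ ≤ κ k₀ * (W 0 * Real.exp (-ω * t)) := mul_le_mul_of_nonneg_left (hdecay t ht) (hκ k₀).le
    _ ≤ (κ k₀ * W 0 + 1) * Real.exp (-ω * t) := by
        nlinarith [Real.exp_pos (-ω * t)]
end
end

section
/- Suppose ρ, ρᵏ ∈ Γ and α_k > 0 satisfy (A(ρ) − A(ρᵏ))ᵀ(A(ρ) − A(ρᵏ)) ⪯ α_k²I. If the scalars τ_{i,ρᵏ} > 0, θ_{i,ρᵏ} > 0 and symmetric positive definite matrices X_{i,ρᵏ}, i = 1,…,N, form a feasible solution of the coupled LMIs at ρᵏ with α = α_k, then the collection {(τ_{i,ρᵏ}, X_{i,ρᵏ}), i = 1,…,N} satisfies the reduced coupled LMIs at ρ: [[Sᵢ(ρ) + τᵢR, Tᵢ], [Tᵢᵀ, −Υᵢ]] ≺ 0 for i = 1,…,N, with τᵢ = τ_{i,ρᵏ} and Xᵢ = X_{i,ρᵏ}. -/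
open MeasureTheory Matrix Set Filter

noncomputable section

namespace NetData

variable {n l m r r0 N : ℕ} (d : NetData n l m r r0 N)

lemma Acl_sub (A B : Matrix (Fin n) (Fin n) ℝ) (i : Fin N) :
    d.Acl A i - d.Acl B i = A - B := by
  simp only [Acl]
  abel

lemma Smat_sub (A B : Matrix (Fin n) (Fin n) ℝ) (X : Fin N → Matrix (Fin n) (Fin n) ℝ)
    (i : Fin N) :
    d.Smat A X i - d.Smat B X i = X i * (A - B) + (A - B)ᵀ * X i := by
  rw [← d.Acl_sub A B i, transpose_sub, mul_sub, sub_mul]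
  simp only [Smat]
  abel

/-- Changing `A(ρ)` changes the reduced quadratic form by a cross term. -/
lemma redQF_eq_add (A B : Matrix (Fin n) (Fin n) ℝ) (τ : Fin N → ℝ)
    (X : Fin N → Matrix (Fin n) (Fin n) ℝ) (i : Fin N) (hX : (X i)ᵀ = X i)
    (ξ : Fin n → ℝ) (a : Fin r0 → ℝ) (bv : Fin r → ℝ) (c : Fin l → ℝ)
    (v : Fin N → Fin n → ℝ) :
    d.redQF A τ X i ξ a bv c v
      = d.redQF B τ X i ξ a bv c v + 2 * (ξ ⬝ᵥ (X i *ᵥ ((A - B) *ᵥ ξ))) := by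
  have hT : ξ ⬝ᵥ (((A - B)ᵀ * X i) *ᵥ ξ) = ξ ⬝ᵥ (X i *ᵥ ((A - B) *ᵥ ξ)) := by
    rw [mulVec_mulVec, ← dotProduct_transpose_mulVec, transpose_mul, hX,
      transpose_transpose]
  have hS : ξ ⬝ᵥ (d.Smat A X i *ᵥ ξ)
      = ξ ⬝ᵥ (d.Smat B X i *ᵥ ξ) + 2 * (ξ ⬝ᵥ (X i *ᵥ ((A - B) *ᵥ ξ))) := by
    rw [← sub_add_cancel (d.Smat A X i) (d.Smat B X i), Smat_sub, add_mulVec, add_mulVec,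
      dotProduct_add, dotProduct_add, hT, ← mulVec_mulVec]
    ring
  simp only [redQF, hS]
  ring

end NetData

lemma dotProduct_mulVec_self_le_of_posSemidef {n : ℕ} {s : ℝ} {M : Matrix (Fin n) (Fin n) ℝ}
    (h : (s • (1 : Matrix (Fin n) (Fin n) ℝ) - Mᵀ * M).PosSemidef) (ξ : Fin n → ℝ) :
    (M *ᵥ ξ) ⬝ᵥ (M *ᵥ ξ) ≤ s * (ξ ⬝ᵥ ξ) := by
  have h0 := h.dotProduct_mulVec_nonneg ξ
  have hM : ξ ⬝ᵥ ((Mᵀ * M) *ᵥ ξ) = (M *ᵥ ξ) ⬝ᵥ (M *ᵥ ξ) := by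
    rw [← mulVec_mulVec, dotProduct_mulVec, vecMul_transpose]
  rw [star_trivial, sub_mulVec, dotProduct_sub, hM, smul_mulVec, one_mulVec,
    dotProduct_smul, smul_eq_mul] at h0
  linarith

/-- **Lemma 2 (STATEMENT 5).** If `(A(ρ) − A(ρᵏ))ᵀ(A(ρ) − A(ρᵏ)) ⪯ αₖ²I` and
`(τᵢ, θᵢ, Xᵢ)` is a feasible solution of the coupled LMIs (12) at `ρᵏ` with
`α = αₖ`, then `(τᵢ, Xᵢ)` satisfies the reduced coupled LMIs (18) at `ρ`. -/
theorem lemma_reduced_LMI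
    {n l m r r0 N : ℕ} (d : NetData n l m r r0 N) (hstand : d.Standing)
    (Aρk Aρ : Matrix (Fin n) (Fin n) ℝ) (αk : ℝ) (hαk : 0 < αk)
    (hmis : (αk ^ 2 • (1 : Matrix (Fin n) (Fin n) ℝ)
        - (Aρ - Aρk)ᵀ * (Aρ - Aρk)).PosSemidef)
    (τ θ : Fin N → ℝ) (X : Fin N → Matrix (Fin n) (Fin n) ℝ)
    (hfeas : d.Feasible Aρk αk τ θ X) :
    d.ReducedLMI Aρ τ X := by
  obtain ⟨-, hθ, hX, hL⟩ := hfeas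
  intro i ξ a bv c v hne
  have hfull := hL i ξ a bv c v ((Aρ - Aρk) *ᵥ ξ)
    fun ⟨h1, h2, h3, h4, h5, _⟩ => hne ⟨h1, h2, h3, h4, h5⟩
  have hXi : (X i)ᵀ = X i := by simpa using (hX i).isHermitian.eq
  have hmono := mul_le_mul_of_nonneg_left
    (dotProduct_mulVec_self_le_of_posSemidef hmis ξ) (hθ i).le
  rw [d.redQF_eq_add Aρ Aρk τ X i hXi]
  simp only [NetData.fullQF] at hfull
  linarith
end
end
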